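/- Let H satisfy Assumption (H), let κ be a decreasing L1-kernel which is not identically zero, and let a : [0,∞) → (−∞, w_*) be continuous and decreasing. Then the nonlinear Volterra equation f(t) = a(t) + ∫₀^t κ(t−s) H(f(s)) ds has a unique global continuous solution f on [0,∞), and this solution satisfies a(t) < f(t) ≤ Q₂⁻¹(∫₀^t κ(s) ds, a(0)) < w_* for all t > 0. -/

import Mathlib

open MeasureTheory Set Filter

/-- Assumption (H): `H : (−∞, w_max] → ℝ` (modeled on all of `ℝ`, with all
conditions imposed on `(−∞, w_max]`) is continuously differentiable and convex,
has a unique root `w_*` in `(−∞, w_max]`, `H′(w_*) < 0` and `H(w_max) < 0`. -/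
def AssumptionH (wmax wstar : ℝ) (H : ℝ → ℝ) : Prop :=
  wstar ≤ wmax ∧
  ContDiffOn ℝ 1 H (Set.Iic wmax) ∧
  ConvexOn ℝ (Set.Iic wmax) H ∧
  H wstar = 0 ∧
  (∀ w ∈ Set.Iic wmax, H w = 0 → w = wstar) ∧
  derivWithin H (Set.Iic wmax) wstar < 0 ∧
  H wmax < 0

/-- An `L_p`-kernel: nonnegative on `[0,∞)`, continuous on `(0,∞)`,
with `∫₀^T κ(t)^p dt < ∞` for all `T > 0`. -/
def IsLpKernel (p : ℝ) (κ : ℝ → ℝ) : Prop :=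
  (∀ t, 0 ≤ t → 0 ≤ κ t) ∧ ContinuousOn κ (Set.Ioi 0) ∧
    ∀ T > 0, MeasureTheory.IntegrableOn (fun t => κ t ^ p) (Set.Ioc 0 T)

section Convolution

variable {k y : ℝ → ℝ}

lemma kernel_intervalIntegrable (hk : ∀ T, 0 ≤ T → IntervalIntegrable k volume 0 T)
    {p q : ℝ} (hp : 0 ≤ p) (hq : 0 ≤ q) : IntervalIntegrable k volume p q :=
  (hk p hp).symm.trans (hk q hq)

lemma convolution_intervalIntegrable (hk : ∀ T, 0 ≤ T → IntervalIntegrable k volume 0 T)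
    {p q t : ℝ} (hpq : p ≤ q) (hqt : q ≤ t) (hy : ContinuousOn y (Icc p q)) :
    IntervalIntegrable (fun s => k (t - s) * y s) volume p q := by
  have h := (kernel_intervalIntegrable hk (p := t - p) (q := t - q)
    (by linarith) (by linarith)).comp_sub_left t
  simp only [sub_sub_cancel] at h
  exact h.mul_continuousOn (by rwa [uIcc_of_le hpq])

lemma integral_kernel_comp_sub (t p q : ℝ) :
    ∫ s in p..q, k (t - s) = ∫ u in (t - q)..(t - p), k u :=
  intervalIntegral.integral_comp_sub_left k t

lemma primitive_mono (hk0 : ∀ t, 0 ≤ t → 0 ≤ k t)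
    (hk : ∀ T, 0 ≤ T → IntervalIntegrable k volume 0 T) {s t : ℝ} (hs : 0 ≤ s) (hst : s ≤ t) :
    ∫ u in (0 : ℝ)..s, k u ≤ ∫ u in (0 : ℝ)..t, k u := by
  rw [← intervalIntegral.integral_add_adjacent_intervals (hk s hs)
    (kernel_intervalIntegrable hk hs (hs.trans hst))]
  have := intervalIntegral.integral_nonneg (μ := volume) hst
    (fun u hu => hk0 u (hs.trans hu.1))
  linarith

lemma continuousOn_primitive (hk : ∀ T, 0 ≤ T → IntervalIntegrable k volume 0 T)
    {T : ℝ} (hT : 0 ≤ T) : ContinuousOn (fun t => ∫ u in (0 : ℝ)..t, k u) (Icc 0 T) := by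
  have := intervalIntegral.continuousOn_primitive_interval (μ := volume) (f := k) (a := 0) (b := T)
    ((intervalIntegrable_iff' (by simp)).1 (hk T hT))
  rwa [uIcc_of_le hT] at this

/-- Convolution of a locally integrable kernel with a continuous function is continuous. -/
lemma continuousOn_convolution (hk : ∀ T, 0 ≤ T → IntervalIntegrable k volume 0 T)
    {T : ℝ} (hT : 0 ≤ T) (hy : ContinuousOn y (Icc 0 T)) :
    ContinuousOn (fun t => ∫ s in (0 : ℝ)..t, k (t - s) * y s) (Icc 0 T) := by
  let Y : C(Icc (0 : ℝ) T, ℝ) := ⟨fun s => y s, hy.domRestrict⟩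
  let z : ℝ → ℝ := IccExtend hT Y
  have hz : Continuous z := Y.continuous.Icc_extend'
  have hzy : ∀ s ∈ Icc 0 T, z s = y s := fun s hs => IccExtend_of_mem hT _ hs
  have hzb : ∀ s, ‖z s‖ ≤ ‖Y‖ := fun s => Y.norm_coe_le_norm _
  have key : ∀ t ∈ Icc 0 T, (∫ s in (0 : ℝ)..t, k (t - s) * y s) =
      (∫ u in (0 : ℝ)..T, k u * (z (max (t - u) 0) - z 0)) + (∫ u in (0 : ℝ)..t, k u) * z 0 := by
    intro t ht
    have i1 : IntervalIntegrable (fun u => k u * (z (max (t - u) 0) - z 0)) volume 0 t :=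
      (hk t ht.1).mul_continuousOn (by fun_prop)
    have i2 : IntervalIntegrable (fun u => k u * (z (max (t - u) 0) - z 0)) volume t T :=
      (kernel_intervalIntegrable hk ht.1 hT).mul_continuousOn (by fun_prop)
    have e2 : (∫ u in t..T, k u * (z (max (t - u) 0) - z 0)) = 0 := by
      rw [intervalIntegral.integral_congr (g := fun _ => 0)]
      · simp
      · intro u hu
        rw [uIcc_of_le ht.2] at hu
        simp [max_eq_right (sub_nonpos.2 hu.1)]
    rw [← intervalIntegral.integral_add_adjacent_intervals i1 i2, e2, add_zero,
      ← intervalIntegral.integral_mul_const, ← intervalIntegral.integral_add i1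
        ((hk t ht.1).mul_const _)]
    have e3 := intervalIntegral.integral_comp_sub_left (a := 0) (b := t)
      (fun u => k u * y (t - u)) t
    simp only [sub_sub_cancel, sub_self, sub_zero] at e3
    rw [e3]
    refine intervalIntegral.integral_congr fun u hu => ?_
    rw [uIcc_of_le ht.1] at hu
    rw [max_eq_left (sub_nonneg.2 hu.2),
      hzy (t - u) ⟨by linarith [hu.2], by linarith [hu.1, ht.2]⟩]
    ring
  refine ContinuousOn.congr (ContinuousOn.add ?_ ((continuousOn_primitive hk hT).mul
    continuousOn_const)) key
  refine Continuous.continuousOn ?_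
  refine intervalIntegral.continuous_of_dominated_interval
    (bound := fun u => ‖k u‖ * (‖Y‖ + ‖Y‖)) ?_ ?_ ((hk T hT).norm.mul_const _) ?_
  · intro t
    exact ((hk T hT).mul_continuousOn (by fun_prop)).aestronglyMeasurable_restrict_uIoc
  · intro t
    refine Eventually.of_forall fun u _ => ?_
    rw [norm_mul]
    gcongr
    exact (norm_sub_le _ _).trans (add_le_add (hzb _) (hzb _))
  · exact Eventually.of_forall fun u _ => by fun_prop

/-- Fixed point of a contractive Volterra operator. -/
lemma exists_volterra_solution_of_contraction {T : ℝ} (hT : 0 ≤ T)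
    (hk0 : ∀ t, 0 ≤ t → 0 ≤ k t) (hk : ∀ T, 0 ≤ T → IntervalIntegrable k volume 0 T)
    {F : ℝ → ℝ → ℝ} (hF : Continuous (Function.uncurry F)) {L : ℝ} (hL0 : 0 ≤ L)
    (hL : ∀ s u v, |F s u - F s v| ≤ L * |u - v|)
    (hlt : L * ∫ u in (0 : ℝ)..T, k u < 1) {b : ℝ → ℝ} (hb : ContinuousOn b (Icc 0 T)) :
    ∃ g : ℝ → ℝ, ContinuousOn g (Icc 0 T) ∧
      ∀ t ∈ Icc 0 T, g t = b t + ∫ s in (0 : ℝ)..t, k (t - s) * F s (g s) := by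
  have hext : ∀ g : C(Icc (0 : ℝ) T, ℝ), Continuous (IccExtend hT g) := fun g =>
    g.continuous.Icc_extend'
  have hFg : ∀ g : C(Icc (0 : ℝ) T, ℝ), Continuous fun s => F s (IccExtend hT g s) := fun g =>
    hF.comp (continuous_id.prodMk (hext g))
  let Φ : C(Icc (0 : ℝ) T, ℝ) → C(Icc (0 : ℝ) T, ℝ) := fun g =>
    ⟨fun t => b t + ∫ s in (0 : ℝ)..t, k (t - s) * F s (IccExtend hT g s),
      (hb.add (continuousOn_convolution hk hT (hFg g).continuousOn)).domRestrict⟩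
  have hq0 : 0 ≤ L * ∫ u in (0 : ℝ)..T, k u :=
    mul_nonneg hL0 (intervalIntegral.integral_nonneg hT fun u hu => hk0 u hu.1)
  have hΦ : ContractingWith ⟨L * ∫ u in (0 : ℝ)..T, k u, hq0⟩ Φ := by
    refine ⟨by exact_mod_cast hlt, LipschitzWith.of_dist_le_mul fun g₁ g₂ => ?_⟩
    refine (ContinuousMap.dist_le (mul_nonneg hq0 dist_nonneg)).2 fun t => ?_
    have i1 := convolution_intervalIntegrable hk t.2.1 le_rfl (hFg g₁).continuousOn
    have i2 := convolution_intervalIntegrable hk t.2.1 le_rfl (hFg g₂).continuousOn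
    have ik := convolution_intervalIntegrable hk t.2.1 le_rfl
      (continuousOn_const (c := L * dist g₁ g₂))
    change dist (b t + _) (b t + _) ≤ (L * ∫ u in (0 : ℝ)..T, k u) * dist g₁ g₂
    rw [dist_add_left, Real.dist_eq, ← intervalIntegral.integral_sub i1 i2, ← Real.norm_eq_abs]
    calc _ ≤ ∫ s in (0 : ℝ)..t, k (t - s) * (L * dist g₁ g₂) := by
          refine intervalIntegral.norm_integral_le_of_norm_le t.2.1 ?_ ik
          refine Eventually.of_forall fun s hs => ?_
          have := hk0 (t - s) (by linarith [hs.2])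
          rw [← mul_sub, norm_mul, Real.norm_of_nonneg this]
          refine mul_le_mul_of_nonneg_left ((hL _ _ _).trans ?_) this
          exact mul_le_mul_of_nonneg_left (ContinuousMap.dist_apply_le_dist (f := g₁) (g := g₂) _)
            hL0
      _ = L * (∫ u in (0 : ℝ)..t, k u) * dist g₁ g₂ := by
          rw [intervalIntegral.integral_mul_const, integral_kernel_comp_sub]
          simp only [sub_self, sub_zero]
          ring
      _ ≤ _ := by
          gcongr
          exact primitive_mono hk0 hk t.2.1 t.2.2
  refine ⟨IccExtend hT hΦ.fixedPoint, (hext _).continuousOn, fun t ht => ?_⟩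
  have := congrArg (fun g : C(Icc (0 : ℝ) T, ℝ) => g ⟨t, ht⟩) hΦ.fixedPoint_isFixedPt
  rw [IccExtend_of_mem hT _ ht]
  exact this.symm

/-- The exponentially weighted mass of a kernel on `[0, T]` can be made arbitrarily small. -/
lemma exists_exp_weight (hk : ∀ T, 0 ≤ T → IntervalIntegrable k volume 0 T)
    {T : ℝ} (hT : 0 ≤ T) (L : ℝ) :
    ∃ c : ℝ, L * ∫ u in (0 : ℝ)..T, k u * Real.exp (-(c * u)) < 1 := by
  have h : Tendsto (fun c : ℝ => ∫ u in (0 : ℝ)..T, k u * Real.exp (-(c * u))) atTop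
      (nhds (∫ u in (0 : ℝ)..T, (0 : ℝ))) := by
    refine intervalIntegral.tendsto_integral_filter_of_dominated_convergence (fun u => ‖k u‖)
      ?_ ?_ (hk T hT).norm ?_
    · exact Eventually.of_forall fun c =>
        ((hk T hT).mul_continuousOn (by fun_prop)).aestronglyMeasurable_restrict_uIoc
    · filter_upwards [eventually_ge_atTop 0] with c hc
      refine Eventually.of_forall fun u hu => ?_
      rw [uIoc_of_le hT] at hu
      rw [norm_mul, Real.norm_of_nonneg (Real.exp_pos _).le]
      refine mul_le_of_le_one_right (norm_nonneg _) (Real.exp_le_one_iff.2 ?_)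
      have := mul_nonneg hc hu.1.le
      linarith
    · refine Eventually.of_forall fun u hu => ?_
      rw [uIoc_of_le hT] at hu
      have := (Real.tendsto_exp_neg_atTop_nhds_zero.comp
        (tendsto_id.atTop_mul_const hu.1)).const_mul (k u)
      simpa using this
  have h2 := h.const_mul L
  simp only [intervalIntegral.integral_zero, mul_zero] at h2
  exact (h2.eventually_lt_const one_pos).exists

/-- Global solvability of a Volterra equation with Lipschitz nonlinearity. -/
lemma exists_volterra_solution {T : ℝ} (hT : 0 ≤ T)
    (hk0 : ∀ t, 0 ≤ t → 0 ≤ k t) (hk : ∀ T, 0 ≤ T → IntervalIntegrable k volume 0 T)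
    {g : ℝ → ℝ} {L : ℝ} (hL0 : 0 ≤ L) (hg : Continuous g)
    (hL : ∀ u v, |g u - g v| ≤ L * |u - v|) {a : ℝ → ℝ} (ha : ContinuousOn a (Icc 0 T)) :
    ∃ f : ℝ → ℝ, ContinuousOn f (Icc 0 T) ∧
      ∀ t ∈ Icc 0 T, f t = a t + ∫ s in (0 : ℝ)..t, k (t - s) * g (f s) := by
  obtain ⟨c, hc⟩ := exists_exp_weight hk hT L
  obtain ⟨φ, hφ, hφe⟩ := exists_volterra_solution_of_contraction
    (k := fun u => k u * Real.exp (-(c * u)))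
    (F := fun s w => Real.exp (-(c * s)) * g (Real.exp (c * s) * w))
    (b := fun t => Real.exp (-(c * t)) * a t) hT
    (fun t ht => mul_nonneg (hk0 t ht) (Real.exp_pos _).le)
    (fun S hS => (hk S hS).mul_continuousOn (by fun_prop))
    (by unfold Function.uncurry; fun_prop) hL0
    (fun s u v => by
      rw [← mul_sub, abs_mul, Real.abs_exp]
      calc _ ≤ Real.exp (-(c * s)) * (L * |Real.exp (c * s) * u - Real.exp (c * s) * v|) := by
            gcongr
            exact hL _ _
        _ = (Real.exp (-(c * s)) * Real.exp (c * s)) * (L * |u - v|) := by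
            rw [← mul_sub, abs_mul, Real.abs_exp]
            ring
        _ = _ := by rw [← Real.exp_add]; simp)
    hc (by fun_prop)
  refine ⟨fun t => Real.exp (c * t) * φ t, by fun_prop, fun t ht => ?_⟩
  simp only
  nth_rewrite 1 [hφe t ht]
  rw [mul_add, ← mul_assoc, ← Real.exp_add, add_neg_cancel, Real.exp_zero, one_mul,
    ← intervalIntegral.integral_const_mul]
  congr 1
  refine intervalIntegral.integral_congr fun s _ => ?_
  calc _ = (Real.exp (c * t) * Real.exp (-(c * (t - s))) * Real.exp (-(c * s))) *
        (k (t - s) * g (Real.exp (c * s) * φ s)) := by ring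
    _ = _ := by
      rw [← Real.exp_add, ← Real.exp_add]
      ring_nf
      simp

/-- A Gronwall-type lemma for convolution kernels. -/
lemma nonpos_of_le_convolution {T : ℝ} (hT : 0 ≤ T)
    (hk0 : ∀ t, 0 ≤ t → 0 ≤ k t) (hk : ∀ T, 0 ≤ T → IntervalIntegrable k volume 0 T)
    {L : ℝ} (hL0 : 0 ≤ L) {d : ℝ → ℝ} (hd : ContinuousOn d (Icc 0 T))
    (hle : ∀ t ∈ Icc 0 T, d t ≤ L * ∫ s in (0 : ℝ)..t, k (t - s) * d s) :
    ∀ t ∈ Icc 0 T, d t ≤ 0 := by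
  obtain ⟨c, hc⟩ := exists_exp_weight hk hT L
  obtain ⟨τ, hτ, hmax⟩ := isCompact_Icc.exists_isMaxOn (nonempty_Icc.2 hT)
    (f := fun t => Real.exp (-(c * t)) * d t) (by fun_prop)
  set M := Real.exp (-(c * τ)) * d τ with hM
  have hdM : ∀ s ∈ Icc 0 T, d s ≤ Real.exp (c * s) * M := by
    intro s hs
    have h1 : Real.exp (-(c * s)) * d s ≤ M := hmax hs
    calc d s = Real.exp (c * s) * (Real.exp (-(c * s)) * d s) := by
          rw [← mul_assoc, ← Real.exp_add]; simp
      _ ≤ _ := by gcongr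
  suffices hM0 : M ≤ 0 by
    intro t ht
    exact (hdM t ht).trans (mul_nonpos_of_nonneg_of_nonpos (Real.exp_pos _).le hM0)
  by_contra! hpos
  have hsub : Icc 0 τ ⊆ Icc 0 T := Icc_subset_Icc le_rfl hτ.2
  have h1 : ∫ s in (0 : ℝ)..τ, k (τ - s) * d s ≤
      ∫ s in (0 : ℝ)..τ, k (τ - s) * (Real.exp (c * s) * M) := by
    refine intervalIntegral.integral_mono_on hτ.1
      (convolution_intervalIntegrable hk hτ.1 le_rfl (hd.mono hsub))
      (convolution_intervalIntegrable hk hτ.1 le_rfl (by fun_prop)) fun s hs => ?_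
    exact mul_le_mul_of_nonneg_left (hdM s (hsub hs)) (hk0 _ (by linarith [hs.2]))
  have h2 : ∫ s in (0 : ℝ)..τ, k (τ - s) * (Real.exp (c * s) * M) =
      Real.exp (c * τ) * M * ∫ u in (0 : ℝ)..τ, k u * Real.exp (-(c * u)) := by
    have e := intervalIntegral.integral_comp_sub_left (a := 0) (b := τ)
      (fun u => k u * Real.exp (-(c * u))) τ
    simp only [sub_self, sub_zero] at e
    rw [← e, ← intervalIntegral.integral_const_mul]
    refine intervalIntegral.integral_congr fun s _ => ?_
    have : Real.exp (c * s) = Real.exp (c * τ) * Real.exp (-(c * (τ - s))) := by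
      rw [← Real.exp_add]; ring_nf
    rw [this]; ring
  have h3 : ∫ u in (0 : ℝ)..τ, k u * Real.exp (-(c * u)) ≤
      ∫ u in (0 : ℝ)..T, k u * Real.exp (-(c * u)) :=
    primitive_mono (fun t ht => mul_nonneg (hk0 t ht) (Real.exp_pos _).le)
      (fun S hS => (hk S hS).mul_continuousOn (by fun_prop)) hτ.1 hτ.2
  have h4 : d τ = Real.exp (c * τ) * M := by
    rw [hM, ← mul_assoc, ← Real.exp_add]; simp
  have h5 := hle τ hτ
  have h6 : 0 < Real.exp (c * τ) * M := mul_pos (Real.exp_pos _) hpos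
  nlinarith [mul_le_mul_of_nonneg_left (h1.trans_eq h2) hL0,
    mul_le_mul_of_nonneg_left h3 (mul_nonneg hL0 h6.le), mul_lt_mul_of_pos_left hc h6]

/-- Uniqueness for Volterra equations whose nonlinearity is Lipschitz on the common range. -/
lemma volterra_unique {T : ℝ} (hT : 0 ≤ T)
    (hk0 : ∀ t, 0 ≤ t → 0 ≤ k t) (hk : ∀ T, 0 ≤ T → IntervalIntegrable k volume 0 T)
    {g : ℝ → ℝ} {S : Set ℝ} {L : NNReal} (hL : LipschitzOnWith L g S) {a f₁ f₂ : ℝ → ℝ}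
    (hc₁ : ContinuousOn f₁ (Icc 0 T)) (hc₂ : ContinuousOn f₂ (Icc 0 T))
    (hm₁ : MapsTo f₁ (Icc 0 T) S) (hm₂ : MapsTo f₂ (Icc 0 T) S)
    (he₁ : ∀ t ∈ Icc 0 T, f₁ t = a t + ∫ s in (0 : ℝ)..t, k (t - s) * g (f₁ s))
    (he₂ : ∀ t ∈ Icc 0 T, f₂ t = a t + ∫ s in (0 : ℝ)..t, k (t - s) * g (f₂ s)) :
    EqOn f₁ f₂ (Icc 0 T) := by
  have hd : ContinuousOn (fun t => |f₁ t - f₂ t|) (Icc 0 T) := (hc₁.sub hc₂).abs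
  have hg₁ := hL.continuousOn.comp hc₁ hm₁
  have hg₂ := hL.continuousOn.comp hc₂ hm₂
  intro t ht
  have := nonpos_of_le_convolution hT hk0 hk L.coe_nonneg hd (fun t ht => ?_) t ht
  · exact sub_eq_zero.1 (abs_nonpos_iff.1 this)
  have hsub : Icc 0 t ⊆ Icc 0 T := Icc_subset_Icc le_rfl ht.2
  have i1 := convolution_intervalIntegrable hk ht.1 le_rfl (hg₁.mono hsub)
  have i2 := convolution_intervalIntegrable hk ht.1 le_rfl (hg₂.mono hsub)
  have i3 := convolution_intervalIntegrable hk ht.1 le_rfl (hd.mono hsub)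
  rw [he₁ t ht, he₂ t ht, add_sub_add_left_eq_sub, ← Real.norm_eq_abs,
    ← intervalIntegral.integral_const_mul]
  simp only [Function.comp_apply] at i1 i2
  rw [← intervalIntegral.integral_sub i1 i2]
  refine intervalIntegral.norm_integral_le_of_norm_le ht.1 ?_ (i3.const_mul _)
  refine Eventually.of_forall fun s hs => ?_
  have hs' : s ∈ Icc 0 T := ⟨hs.1.le, hs.2.trans ht.2⟩
  have h0 := hk0 (t - s) (by linarith [hs.2])
  rw [← mul_sub, norm_mul, Real.norm_of_nonneg h0]
  calc _ ≤ k (t - s) * (L * ‖f₁ s - f₂ s‖) :=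
        mul_le_mul_of_nonneg_left (hL.norm_sub_le (hm₁ hs') (hm₂ hs')) h0
    _ = _ := by rw [Real.norm_eq_abs]; ring

end Convolution

section Barrier

variable {k : ℝ → ℝ}

/-- Increments of a convolution with an antitone kernel are controlled by a lower bound `h` of the
second factor. -/
lemma convolution_increment_le
    (hk : ∀ T, 0 ≤ T → IntervalIntegrable k volume 0 T) (hdec : AntitoneOn k (Ioi 0))
    {y : ℝ → ℝ} {t τ h : ℝ} (ht : 0 ≤ t) (htτ : t ≤ τ) (hy : ContinuousOn y (Icc 0 τ))
    (hh : ∀ s ∈ Icc 0 τ, h ≤ y s) :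
    (∫ s in (0 : ℝ)..τ, k (τ - s) * y s) - (∫ s in (0 : ℝ)..t, k (t - s) * y s) ≤
      h * (∫ u in t..τ, k u) + ∫ s in t..τ, k (τ - s) * (y s - h) := by
  have hτ := ht.trans htτ
  have hz : ContinuousOn (fun s => y s - h) (Icc 0 τ) := hy.sub continuousOn_const
  have hz1 := hz.mono (Icc_subset_Icc le_rfl htτ)
  have hz2 := hz.mono (Icc_subset_Icc ht le_rfl)
  have split : ∀ r, 0 ≤ r → r ≤ τ → (∫ s in (0 : ℝ)..r, k (r - s) * y s) =
      (∫ s in (0 : ℝ)..r, k (r - s) * (y s - h)) + h * ∫ u in (0 : ℝ)..r, k u := by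
    intro r hr hrτ
    have e := integral_kernel_comp_sub (k := k) r 0 r
    simp only [sub_self, sub_zero] at e
    rw [← e, mul_comm h, ← intervalIntegral.integral_mul_const, ← intervalIntegral.integral_add
      (convolution_intervalIntegrable hk hr le_rfl (hz.mono (Icc_subset_Icc le_rfl hrτ)))
      (convolution_intervalIntegrable hk hr le_rfl continuousOn_const)]
    exact intervalIntegral.integral_congr fun s _ => by ring
  have j1 := convolution_intervalIntegrable hk ht htτ hz1
  have j2 := convolution_intervalIntegrable hk htτ le_rfl hz2
  have j3 := convolution_intervalIntegrable hk ht le_rfl hz1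
  have mono : ∫ s in (0 : ℝ)..t, k (τ - s) * (y s - h) ≤
      ∫ s in (0 : ℝ)..t, k (t - s) * (y s - h) := by
    refine intervalIntegral.integral_mono_on_of_le_Ioo ht j1 j3 fun s hs => ?_
    refine mul_le_mul_of_nonneg_right (hdec ?_ ?_ (by linarith))
      (sub_nonneg.2 (hh s ⟨hs.1.le, hs.2.le.trans htτ⟩))
    · exact mem_Ioi.2 (by linarith [hs.2])
    · exact mem_Ioi.2 (by linarith [hs.2])
  rw [split τ hτ le_rfl, split t ht htτ,
    ← intervalIntegral.integral_add_adjacent_intervals j1 j2,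
    ← intervalIntegral.integral_add_adjacent_intervals (hk t ht)
      (kernel_intervalIntegrable hk ht hτ)]
  linarith

/-- Near a time `τ` where a solution attains its running maximum, its increments are controlled by
the increments of the primitive of the kernel. -/
lemma increment_le_of_running_max (hk0 : ∀ t, 0 ≤ t → 0 ≤ k t)
    (hk : ∀ T, 0 ≤ T → IntervalIntegrable k volume 0 T) (hdec : AntitoneOn k (Ioi 0))
    {g : ℝ → ℝ} (hganti : Antitone g) (hg0 : ∀ w, 0 ≤ g w) {L : ℝ}
    (hg : Continuous g) (hL : ∀ u v, |g u - g v| ≤ L * |u - v|) (hL0 : 0 ≤ L)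
    {a f : ℝ → ℝ} {τ δ : ℝ} (hδ0 : 0 ≤ δ) (hδτ : δ ≤ τ)
    (ha : AntitoneOn a (Ici 0)) (hf : ContinuousOn f (Icc 0 τ))
    (he : ∀ t ∈ Icc 0 τ, f t = a t + ∫ s in (0 : ℝ)..t, k (t - s) * g (f s))
    (hmax : ∀ s ∈ Icc 0 τ, f s ≤ f τ) (hδ : L * (∫ u in (0 : ℝ)..δ, k u) ≤ 1) :
    ∀ s ∈ Icc (τ - δ) τ,
      (f τ - f s) * (1 - L * ∫ u in (0 : ℝ)..δ, k u) ≤ g (f τ) * ∫ u in (τ - δ)..τ, k u := by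
  have hτ : 0 ≤ τ := hδ0.trans hδτ
  have hsub : Icc (τ - δ) τ ⊆ Icc 0 τ := Icc_subset_Icc (by linarith) le_rfl
  obtain ⟨r, hr, hrmin⟩ := isCompact_Icc.exists_isMinOn
    (nonempty_Icc.2 (by linarith : τ - δ ≤ τ)) (hf.mono hsub)
  have hr0 := hsub hr
  have hD0 : 0 ≤ f τ - f r := sub_nonneg.2 (hmax r hr0)
  have hgf : ContinuousOn (fun s => g (f s)) (Icc 0 τ) := hg.comp_continuousOn hf
  have inc := convolution_increment_le hk hdec hr0.1 hr.2 hgf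
    (fun s hs => hganti (hmax s hs))
  have ha' : a τ ≤ a r := ha hr0.1 hτ hr.2
  have i1 := convolution_intervalIntegrable hk hr.2 le_rfl
    ((hgf.sub (continuousOn_const (c := g (f τ)))).mono (Icc_subset_Icc hr0.1 le_rfl))
  have err : ∫ s in r..τ, k (τ - s) * (g (f s) - g (f τ)) ≤
      ∫ s in r..τ, k (τ - s) * (L * (f τ - f r)) := by
    refine intervalIntegral.integral_mono_on hr.2 i1
      (convolution_intervalIntegrable hk hr.2 le_rfl continuousOn_const) fun s hs => ?_
    refine mul_le_mul_of_nonneg_left ?_ (hk0 _ (by linarith [hs.2]))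
    have h1 : f r ≤ f s := hrmin ⟨hr.1.trans hs.1, hs.2⟩
    have h2 : f s ≤ f τ := hmax s ⟨hr0.1.trans hs.1, hs.2⟩
    refine (le_abs_self _).trans ((hL _ _).trans (mul_le_mul_of_nonneg_left ?_ hL0))
    rw [abs_sub_comm, abs_of_nonneg (by linarith)]
    linarith
  rw [intervalIntegral.integral_mul_const, integral_kernel_comp_sub, sub_self] at err
  have m1 : ∫ u in (0 : ℝ)..(τ - r), k u ≤ ∫ u in (0 : ℝ)..δ, k u :=
    primitive_mono hk0 hk (by linarith [hr.2]) (by linarith [hr.1])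
  have m2 : ∫ u in r..τ, k u ≤ ∫ u in (τ - δ)..τ, k u := by
    rw [← intervalIntegral.integral_add_adjacent_intervals
      (kernel_intervalIntegrable hk (by linarith : 0 ≤ τ - δ) hr0.1)
      (kernel_intervalIntegrable hk hr0.1 hτ)]
    have := intervalIntegral.integral_nonneg (μ := volume) hr.1
      (fun u hu => hk0 u (by linarith [hu.1]))
    linarith
  have hDr : (f τ - f r) * (1 - L * ∫ u in (0 : ℝ)..δ, k u) ≤
      g (f τ) * ∫ u in (τ - δ)..τ, k u := by
    have e1 := he τ ⟨hτ, le_rfl⟩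
    have e2 := he r hr0
    have n1 := mul_le_mul_of_nonneg_left m2 (hg0 (f τ))
    have n2 := mul_le_mul_of_nonneg_right m1 (mul_nonneg hL0 hD0)
    linarith
  intro s hs
  have h1 : f r ≤ f s := hrmin hs
  refine le_trans (mul_le_mul_of_nonneg_right (by linarith) (by linarith)) hDr

/-- First time at which a continuous function becomes nonnegative. -/
lemma exists_first_nonneg {u : ℝ → ℝ} {T t : ℝ} (hu : ContinuousOn u (Icc 0 T))
    (h0 : u 0 < 0) (ht : t ∈ Icc 0 T) (hut : 0 ≤ u t) :
    ∃ τ ∈ Ioc 0 T, 0 ≤ u τ ∧ ∀ s, 0 ≤ s → s < τ → u s < 0 := by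
  have hc : IsCompact (Icc 0 T ∩ u ⁻¹' Ici 0) :=
    isCompact_Icc.of_isClosed_subset (hu.preimage_isClosed_of_isClosed isClosed_Icc isClosed_Ici)
      inter_subset_left
  obtain ⟨τ, hτ, hleast⟩ := hc.exists_isLeast ⟨t, ht, hut⟩
  refine ⟨τ, ⟨lt_of_le_of_ne hτ.1.1 ?_, hτ.1.2⟩, hτ.2, fun s hs hsτ => ?_⟩
  · rintro rfl
    exact absurd hτ.2 (not_le.2 h0)
  · by_contra! hus
    exact absurd (hleast ⟨⟨hs, hsτ.le.trans hτ.1.2⟩, hus⟩) (not_le.2 hsτ)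

lemma exists_small_primitive (hk : ∀ T, 0 ≤ T → IntervalIntegrable k volume 0 T)
    {τ ε : ℝ} (hτ : 0 < τ) (hε : 0 < ε) :
    ∃ δ, 0 < δ ∧ δ ≤ τ ∧ ∫ u in (0 : ℝ)..δ, k u < ε := by
  have h := continuousOn_primitive hk hτ.le 0 ⟨le_rfl, hτ.le⟩
  unfold ContinuousWithinAt at h
  simp only [intervalIntegral.integral_same] at h
  have h' := h.mono_left (nhdsWithin_mono 0 (Ioc_subset_Icc_self (a := 0) (b := τ)))
  have hne : (nhdsWithin (0 : ℝ) (Ioc 0 τ)).NeBot := by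
    rw [nhdsWithin_Ioc_eq_nhdsGT hτ]
    infer_instance
  obtain ⟨δ, h1, h2⟩ := ((h'.eventually_lt_const hε).and self_mem_nhdsWithin).exists
  exact ⟨δ, h2.1, h2.2, h1⟩

/-- A solution starting below a zero of the nonlinearity stays below it. -/
lemma solution_lt_root (hk0 : ∀ t, 0 ≤ t → 0 ≤ k t)
    (hk : ∀ T, 0 ≤ T → IntervalIntegrable k volume 0 T) (hdec : AntitoneOn k (Ioi 0))
    {g : ℝ → ℝ} (hganti : Antitone g) (hg0 : ∀ w, 0 ≤ g w) {L : ℝ}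
    (hg : Continuous g) (hL : ∀ u v, |g u - g v| ≤ L * |u - v|) (hL0 : 0 ≤ L)
    {wstar : ℝ} (hroot : g wstar = 0) {a f : ℝ → ℝ} {T : ℝ}
    (ha : AntitoneOn a (Ici 0)) (ha0 : a 0 < wstar) (hf : ContinuousOn f (Icc 0 T))
    (he : ∀ t ∈ Icc 0 T, f t = a t + ∫ s in (0 : ℝ)..t, k (t - s) * g (f s)) :
    ∀ t ∈ Icc 0 T, f t < wstar := by
  intro t ht
  by_contra! hcon
  have hf0 : f 0 = a 0 := by
    simpa using he 0 ⟨le_rfl, ht.1.trans ht.2⟩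
  obtain ⟨τ, hτ, hτw, hlt⟩ := exists_first_nonneg (u := fun s => f s - wstar)
    (hf.sub continuousOn_const) (by linarith) ht (by linarith)
  have hsub : Icc 0 τ ⊆ Icc 0 T := Icc_subset_Icc le_rfl hτ.2
  obtain ⟨δ, hδ, hδτ, hsmall⟩ := exists_small_primitive hk hτ.1
    (ε := 1 / (L + 1)) (by positivity)
  have hK0 : 0 ≤ ∫ u in (0 : ℝ)..δ, k u :=
    intervalIntegral.integral_nonneg hδ.le fun u hu => hk0 u hu.1
  have hLK : L * (∫ u in (0 : ℝ)..δ, k u) < 1 := by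
    rw [lt_div_iff₀ (by positivity)] at hsmall
    nlinarith
  have key := increment_le_of_running_max hk0 hk hdec hganti hg0 hg hL hL0 hδ.le hδτ ha
    (hf.mono hsub) (fun t ht => he t (hsub ht)) (fun s hs => ?_) hLK.le (τ - δ)
    ⟨le_rfl, by linarith⟩
  · have h1 := hlt (τ - δ) (by linarith) (by linarith)
    have h2 : g (f τ) = 0 :=
      le_antisymm (hroot ▸ hganti (by linarith : wstar ≤ f τ)) (hg0 _)
    rw [h2, zero_mul] at key
    nlinarith [mul_pos (by linarith : 0 < f τ - f (τ - δ)) (sub_pos.2 hLK)]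
  · rcases hs.2.eq_or_lt with rfl | h
    · exact le_rfl
    · linarith [hlt s hs.1 h]

/-- Comparison of a solution with the solution of the ordinary differential equation
`r' = k g(r)`, `r 0 = a 0`, expressed through the primitive `Q` of `1 / g`. -/
lemma primitive_inv_solution_le (hk0 : ∀ t, 0 ≤ t → 0 ≤ k t)
    (hk : ∀ T, 0 ≤ T → IntervalIntegrable k volume 0 T) (hdec : AntitoneOn k (Ioi 0))
    {g : ℝ → ℝ} (hganti : Antitone g) (hg0 : ∀ w, 0 ≤ g w) {L : ℝ}
    (hg : Continuous g) (hL : ∀ u v, |g u - g v| ≤ L * |u - v|) (hL0 : 0 ≤ L)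
    {a f Q : ℝ → ℝ} {T : ℝ} (ha : AntitoneOn a (Ici 0)) (hf : ContinuousOn f (Icc 0 T))
    (he : ∀ t ∈ Icc 0 T, f t = a t + ∫ s in (0 : ℝ)..t, k (t - s) * g (f s))
    (hgpos : ∀ t ∈ Icc 0 T, 0 < g (f t))
    (hQ0 : Q (a 0) = 0) (hQf : ContinuousOn (fun t => Q (f t)) (Icc 0 T))
    (hQ : ∀ s ∈ Icc 0 T, ∀ t ∈ Icc 0 T, f s ≤ f t →
      (Q (f t) - Q (f s)) * g (f t) ≤ f t - f s)
    (hQmono : ∀ s ∈ Icc 0 T, ∀ t ∈ Icc 0 T, Q (f s) < Q (f t) → f s ≤ f t) :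
    ∀ t ∈ Icc 0 T, Q (f t) ≤ ∫ u in (0 : ℝ)..t, k u := by
  intro t ht
  have hT : 0 ≤ T := ht.1.trans ht.2
  have hf0 : f 0 = a 0 := by simpa using he 0 ⟨le_rfl, hT⟩
  suffices hε : ∀ ε > 0, Q (f t) < (∫ u in (0 : ℝ)..t, k u) + ε * (t + 1) by
    refine le_of_forall_pos_le_add fun η hη => ?_
    have ht1 : 0 < t + 1 := by linarith [ht.1]
    have := hε (η / (t + 1)) (by positivity)
    rw [div_mul_cancel₀ _ ht1.ne'] at this
    exact this.le
  intro ε hε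
  by_contra! hcon
  obtain ⟨τ, hτ, hτw, hlt⟩ := exists_first_nonneg
    (u := fun s => Q (f s) - ((∫ u in (0 : ℝ)..s, k u) + ε * (s + 1)))
    (hQf.sub ((continuousOn_primitive hk hT).add (by fun_prop)))
    (by simp [hf0, hQ0, hε]) ht (by linarith)
  have hsub : Icc 0 τ ⊆ Icc 0 T := Icc_subset_Icc le_rfl hτ.2
  have hτT : τ ∈ Icc 0 T := ⟨hτ.1.le, hτ.2⟩
  set κ₀ := k (τ / 2) with hκ₀
  have hκ₀0 : 0 ≤ κ₀ := hk0 _ (by linarith [hτ.1])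
  obtain ⟨δ, hδ, hδτ, hsmall⟩ := exists_small_primitive hk (half_pos hτ.1)
    (ε := min (1 / (L + 1)) (ε / (κ₀ + ε)) / (L + 1)) (by positivity)
  have hK0 : 0 ≤ ∫ u in (0 : ℝ)..δ, k u :=
    intervalIntegral.integral_nonneg hδ.le fun u hu => hk0 u hu.1
  set K := ∫ u in (0 : ℝ)..δ, k u with hK
  rw [lt_div_iff₀ (by positivity), lt_min_iff] at hsmall
  have hLK : L * K < ε / (κ₀ + ε) := by nlinarith [hsmall.2]
  rw [lt_div_iff₀ (by positivity)] at hLK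
  have hLK1 : L * K < 1 := by
    have : 1 / (L + 1) ≤ 1 := by rw [div_le_one (by positivity)]; linarith
    nlinarith [hsmall.1]
  have hQlt : ∀ s, 0 ≤ s → s < τ → Q (f s) < Q (f τ) := fun s hs hsτ => by
    have h1 := hlt s hs hsτ
    have h2 := primitive_mono hk0 hk hs hsτ.le
    have h3 := mul_lt_mul_of_pos_left hsτ hε
    linarith
  have hmax : ∀ s ∈ Icc 0 τ, f s ≤ f τ := fun s hs => by
    rcases hs.2.eq_or_lt with rfl | h
    · exact le_rfl
    · exact hQmono s (hsub hs) τ hτT (hQlt s hs.1 h)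
  have hδ0 : 0 ≤ τ - δ := by linarith [hτ.1]
  have key := increment_le_of_running_max hk0 hk hdec hganti hg0 hg hL hL0 hδ.le
    (by linarith [hτ.1]) ha (hf.mono hsub) (fun t ht => he t (hsub ht)) hmax hLK1.le (τ - δ)
    ⟨le_rfl, by linarith⟩
  have hA : ∫ u in (τ - δ)..τ, k u ≤ κ₀ * δ := by
    have := intervalIntegral.integral_mono_on (μ := volume) (by linarith : τ - δ ≤ τ)
      (kernel_intervalIntegrable hk hδ0 hτ.1.le) (intervalIntegrable_const (c := κ₀))
      (fun u hu => hdec (mem_Ioi.2 (half_pos hτ.1))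
        (mem_Ioi.2 (by linarith [hu.1, hτ.1])) (by linarith [hu.1]))
    rw [intervalIntegral.integral_const, smul_eq_mul] at this
    linarith
  set A := ∫ u in (τ - δ)..τ, k u with hAdef
  have hsplit : (∫ u in (0 : ℝ)..τ, k u) = (∫ u in (0 : ℝ)..(τ - δ), k u) + A :=
    (intervalIntegral.integral_add_adjacent_intervals (hk _ hδ0)
      (kernel_intervalIntegrable hk hδ0 hτ.1.le)).symm
  have hinc : A + ε * δ ≤ Q (f τ) - Q (f (τ - δ)) := by
    have h1 := hlt (τ - δ) hδ0 (by linarith)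
    linarith
  have hmem : τ - δ ∈ Icc 0 τ := ⟨hδ0, by linarith⟩
  have hh := hgpos τ hτT
  have h1 : (A + ε * δ) * g (f τ) ≤ f τ - f (τ - δ) :=
    (mul_le_mul_of_nonneg_right hinc hh.le).trans
      (hQ _ (hsub hmem) _ hτT (hmax _ hmem))
  have h2 : (A + ε * δ) * (1 - L * K) * g (f τ) ≤ A * g (f τ) := by
    have := mul_le_mul_of_nonneg_right h1 (by linarith : 0 ≤ 1 - L * K)
    linarith
  have h3 : (A + ε * δ) * (1 - L * K) ≤ A := le_of_mul_le_mul_right h2 hh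
  have h4 : A * (L * K) ≤ κ₀ * δ * (L * K) :=
    mul_le_mul_of_nonneg_right hA (mul_nonneg hL0 hK0)
  have h5 := mul_lt_mul_of_pos_right hLK hδ
  linarith

end Barrier

section Nonlinearity

variable {wmax wstar : ℝ} {H : ℝ → ℝ}

lemma AssumptionH.root_lt (hH : AssumptionH wmax wstar H) : wstar < wmax := by
  obtain ⟨h1, -, -, h4, -, -, h7⟩ := hH
  refine lt_of_le_of_ne h1 ?_
  rintro rfl
  linarith

lemma AssumptionH.pos (hH : AssumptionH wmax wstar H) {w : ℝ} (hw : w < wstar) : 0 < H w := by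
  have hlt := hH.root_lt
  obtain ⟨-, -, hconv, h4, -, -, h7⟩ := hH
  have hs := hconv.slope_mono_adjacent (mem_Iic.2 (hw.le.trans hlt.le)) (mem_Iic.2 le_rfl) hw hlt
  have h : (H wmax - H wstar) / (wmax - wstar) < 0 :=
    div_neg_of_neg_of_pos (by linarith) (by linarith)
  have h' := hs.trans_lt h
  rw [div_lt_iff₀ (by linarith)] at h'
  linarith

lemma AssumptionH.antitoneOn (hH : AssumptionH wmax wstar H) : AntitoneOn H (Iic wstar) := by
  intro x _ y hy hxy
  have hlt := hH.root_lt
  have hy' : y ≤ wstar := hy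
  have hHy : 0 ≤ H y := by
    rcases hy'.eq_or_lt with rfl | h
    · exact hH.2.2.2.1.ge
    · exact (hH.pos h).le
  rcases hxy.eq_or_lt with rfl | hxy
  · exact le_rfl
  have hs := hH.2.2.1.slope_mono_adjacent (mem_Iic.2 (by linarith)) (mem_Iic.2 le_rfl) hxy
    (hy'.trans_lt hlt)
  have h : (H wmax - H y) / (wmax - y) < 0 :=
    div_neg_of_neg_of_pos (by linarith [hH.2.2.2.2.2.2]) (by linarith)
  have h' := hs.trans_lt h
  rw [div_lt_iff₀ (by linarith)] at h'
  linarith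

lemma AssumptionH.exists_lipschitzOnWith (hH : AssumptionH wmax wstar H) (m : ℝ) :
    ∃ L : NNReal, LipschitzOnWith L H (Icc m wmax) :=
  (hH.2.1.mono Icc_subset_Iic_self).exists_lipschitzOnWith one_ne_zero (convex_Icc _ _)
    isCompact_Icc

lemma AssumptionH.continuousOn_inv (hH : AssumptionH wmax wstar H) :
    ContinuousOn (fun ζ => (H ζ)⁻¹) (Iio wstar) :=
  (hH.2.1.continuousOn.mono fun _ hw => (lt_trans hw hH.root_lt).le).inv₀
    fun _ hw => (hH.pos hw).ne'

lemma AssumptionH.intervalIntegrable_inv (hH : AssumptionH wmax wstar H) {u v : ℝ}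
    (hu : u < wstar) (hv : v < wstar) :
    IntervalIntegrable (fun ζ => (H ζ)⁻¹) volume u v :=
  (hH.continuousOn_inv.mono fun _ hw => hw.2.trans_lt (max_lt hu hv)).intervalIntegrable

lemma AssumptionH.continuousOn_primitive_inv (hH : AssumptionH wmax wstar H) {w₀ : ℝ}
    (hw₀ : w₀ < wstar) : ContinuousOn (fun w => ∫ ζ in w₀..w, (H ζ)⁻¹) (Iio wstar) := by
  intro w hw
  exact (intervalIntegral.integral_hasDerivAt_right (hH.intervalIntegrable_inv hw₀ hw)
    (hH.continuousOn_inv.stronglyMeasurableAtFilter isOpen_Iio w hw)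
    (hH.continuousOn_inv.continuousAt (Iio_mem_nhds hw))).continuousAt.continuousWithinAt

lemma AssumptionH.primitive_inv_sub (hH : AssumptionH wmax wstar H) {w₀ u v : ℝ}
    (hw₀ : w₀ < wstar) (hu : u < wstar) (hv : v < wstar) :
    (∫ ζ in w₀..v, (H ζ)⁻¹) - (∫ ζ in w₀..u, (H ζ)⁻¹) = ∫ ζ in u..v, (H ζ)⁻¹ :=
  intervalIntegral.integral_interval_sub_left (hH.intervalIntegrable_inv hw₀ hv)
    (hH.intervalIntegrable_inv hw₀ hu)

lemma AssumptionH.strictMonoOn_primitive_inv (hH : AssumptionH wmax wstar H) {w₀ : ℝ}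
    (hw₀ : w₀ < wstar) : StrictMonoOn (fun w => ∫ ζ in w₀..w, (H ζ)⁻¹) (Iio wstar) := by
  intro u hu v hv huv
  have := intervalIntegral.intervalIntegral_pos_of_pos_on (hH.intervalIntegrable_inv hu hv)
    (fun ζ hζ => inv_pos.2 (hH.pos (hζ.2.trans hv))) huv
  rw [← hH.primitive_inv_sub hw₀ hu hv] at this
  exact sub_pos.1 this

lemma AssumptionH.primitive_inv_sub_mul_le (hH : AssumptionH wmax wstar H) {w₀ u v : ℝ}
    (hw₀ : w₀ < wstar) (hv : v < wstar) (huv : u ≤ v) :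
    ((∫ ζ in w₀..v, (H ζ)⁻¹) - (∫ ζ in w₀..u, (H ζ)⁻¹)) * H v ≤ v - u := by
  have hu := huv.trans_lt hv
  rw [hH.primitive_inv_sub hw₀ hu hv, ← le_div_iff₀ (hH.pos hv)]
  have := intervalIntegral.integral_mono_on huv (hH.intervalIntegrable_inv hu hv)
    (intervalIntegrable_const (c := (H v)⁻¹) (μ := volume)) fun ζ hζ =>
      inv_anti₀ (hH.pos hv) (hH.antitoneOn (hζ.2.trans hv.le) hv.le hζ.2)
  rwa [intervalIntegral.integral_const, smul_eq_mul, ← div_eq_mul_inv] at this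

/-- The primitive of `1 / H` blows up logarithmically at the root of `H`. -/
lemma AssumptionH.exists_primitive_inv_eq (hH : AssumptionH wmax wstar H) {w₀ c : ℝ}
    (hw₀ : w₀ < wstar) (hc : 0 ≤ c) : ∃ w ∈ Ico w₀ wstar, ∫ ζ in w₀..w, (H ζ)⁻¹ = c := by
  obtain ⟨L, hL⟩ := hH.exists_lipschitzOnWith w₀
  have hL1 : (0 : ℝ) < L + 1 := by positivity
  have hbound : ∀ ζ ∈ Ico w₀ wstar, H ζ ≤ (L + 1) * (wstar - ζ) := by
    intro ζ hζ
    have h := hL.norm_sub_le (x := ζ) ⟨hζ.1, hζ.2.le.trans hH.root_lt.le⟩ (y := wstar)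
      ⟨hw₀.le, hH.root_lt.le⟩
    rw [hH.2.2.2.1, sub_zero, norm_sub_rev, Real.norm_of_nonneg (hH.pos hζ.2).le,
      Real.norm_of_nonneg (by linarith [hζ.2])] at h
    linarith [hζ.2]
  set e := Real.exp (-((L + 1) * c)) with he
  have he0 : 0 < e := Real.exp_pos _
  have he1 : e ≤ 1 := Real.exp_le_one_iff.2 (by have := mul_nonneg hL1.le hc; linarith)
  set w₁ := wstar - (wstar - w₀) * e with hw₁
  have hw₁lt : w₁ < wstar := by
    have := mul_pos (sub_pos.2 hw₀) he0
    linarith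
  have hw₀₁ : w₀ ≤ w₁ := by
    have := mul_le_mul_of_nonneg_left he1 (sub_pos.2 hw₀).le
    linarith
  have hval : ∫ ζ in w₀..w₁, (L + 1 : ℝ)⁻¹ * (wstar - ζ)⁻¹ = c := by
    rw [intervalIntegral.integral_const_mul,
      intervalIntegral.integral_comp_sub_left (fun x => x⁻¹) wstar,
      integral_inv_of_pos (by linarith) (by linarith), hw₁, sub_sub_cancel, div_mul_cancel_left₀
      (by linarith), Real.log_inv, he, Real.log_exp, neg_neg, inv_mul_cancel_left₀ hL1.ne']
  have hge : c ≤ ∫ ζ in w₀..w₁, (H ζ)⁻¹ := by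
    rw [← hval]
    refine intervalIntegral.integral_mono_on hw₀₁ ?_ (hH.intervalIntegrable_inv hw₀ hw₁lt)
      fun ζ hζ => ?_
    · refine ContinuousOn.intervalIntegrable ?_
      rw [uIcc_of_le hw₀₁]
      refine continuousOn_const.mul (ContinuousOn.inv₀ (by fun_prop) fun ζ hζ => ?_)
      have := hζ.2
      linarith
    · rw [← mul_inv]
      have hlt := hζ.2.trans_lt hw₁lt
      exact inv_anti₀ (hH.pos hlt) (hbound ζ ⟨hζ.1, hlt⟩)
  have hcont : ContinuousOn (fun w => ∫ ζ in w₀..w, (H ζ)⁻¹) (Icc w₀ w₁) :=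
    (hH.continuousOn_primitive_inv hw₀).mono fun w hw => hw.2.trans_lt hw₁lt
  obtain ⟨w, hw, hwc⟩ := intermediate_value_Icc hw₀₁ hcont
    (show c ∈ Icc _ _ from ⟨by simpa using hc, hge⟩)
  exact ⟨w, ⟨hw.1, hw.2.trans_lt hw₁lt⟩, hwc⟩

/-- On every compact time interval the Volterra equation has a solution that stays above `a`, below
the root of `H`, and satisfies the comparison bound. -/
lemma AssumptionH.exists_solution_on (hH : AssumptionH wmax wstar H) {k : ℝ → ℝ}
    (hk0 : ∀ t, 0 ≤ t → 0 ≤ k t) (hk : ∀ T, 0 ≤ T → IntervalIntegrable k volume 0 T)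
    (hdec : AntitoneOn k (Ioi 0)) {a : ℝ → ℝ} (hacont : ContinuousOn a (Ici 0))
    (hamono : AntitoneOn a (Ici 0)) (ha0 : a 0 < wstar) {T : ℝ} (hT : 0 ≤ T) :
    ∃ f : ℝ → ℝ, ContinuousOn f (Icc 0 T) ∧ ∀ t ∈ Icc 0 T,
      f t = a t + (∫ s in (0 : ℝ)..t, k (t - s) * H (f s)) ∧ f t < wstar ∧
      ∫ ζ in (a 0)..(f t), (H ζ)⁻¹ ≤ ∫ u in (0 : ℝ)..t, k u := by
  have hm : a T ≤ wstar := (hamono self_mem_Ici hT hT).trans ha0.le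
  obtain ⟨L, hL⟩ := hH.exists_lipschitzOnWith (a T)
  let clamp : ℝ → ℝ := fun w => max (a T) (min w wstar)
  have hclamp : ∀ w, clamp w ∈ Icc (a T) wstar := fun w =>
    ⟨le_max_left _ _, max_le hm (min_le_right _ _)⟩
  have hclamp_mono : Monotone clamp := fun u v huv => by
    exact max_le_max le_rfl (min_le_min huv le_rfl)
  have hclamp_eq : ∀ w ∈ Icc (a T) wstar, clamp w = w := fun w hw => by
    simp [clamp, hw.1, hw.2]
  have hclamp_lip : LipschitzWith 1 clamp := (LipschitzWith.id.min_const wstar).const_max (a T)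
  let g : ℝ → ℝ := fun w => H (clamp w)
  have hg_eq : ∀ w ∈ Icc (a T) wstar, g w = H w := fun w hw => congrArg H (hclamp_eq w hw)
  have hganti : Antitone g := fun u v huv =>
    hH.antitoneOn (hclamp u).2 (hclamp v).2 (hclamp_mono huv)
  have hroot : g wstar = 0 := (hg_eq _ ⟨hm, le_rfl⟩).trans hH.2.2.2.1
  have hg0 : ∀ w, 0 ≤ g w := fun w => by
    rw [← hH.2.2.2.1]
    exact hH.antitoneOn (hclamp w).2 self_mem_Iic (hclamp w).2
  have hgL : ∀ u v, |g u - g v| ≤ L * |u - v| := fun u v => by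
    refine (hL.norm_sub_le ⟨(hclamp u).1, (hclamp u).2.trans hH.1⟩
      ⟨(hclamp v).1, (hclamp v).2.trans hH.1⟩).trans ?_
    gcongr
    simpa [Real.dist_eq] using hclamp_lip.dist_le_mul u v
  have hgc : Continuous g :=
    (LipschitzWith.of_dist_le_mul (K := L) fun u v => by
      simpa [Real.dist_eq] using hgL u v).continuous
  obtain ⟨f, hf, hfe⟩ := exists_volterra_solution hT hk0 hk L.coe_nonneg hgc hgL
    (hacont.mono Icc_subset_Ici_self)
  have hlt := solution_lt_root hk0 hk hdec hganti hg0 hgc hgL L.coe_nonneg hroot hamono ha0 hf hfe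
  have hge : ∀ t ∈ Icc 0 T, a T ≤ f t := fun t ht => by
    rw [hfe t ht]
    have h1 : 0 ≤ ∫ s in (0 : ℝ)..t, k (t - s) * g (f s) :=
      intervalIntegral.integral_nonneg ht.1 fun s hs =>
        mul_nonneg (hk0 _ (by linarith [hs.2])) (hg0 _)
    have h2 := hamono ht.1 hT ht.2
    linarith
  have hgf : ∀ t ∈ Icc 0 T, g (f t) = H (f t) := fun t ht => hg_eq _ ⟨hge t ht, (hlt t ht).le⟩
  have hcomp := primitive_inv_solution_le (Q := fun w => ∫ ζ in (a 0)..w, (H ζ)⁻¹) hk0 hk hdec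
    hganti hg0 hgc hgL L.coe_nonneg hamono hf hfe (fun t ht => hgf t ht ▸ hH.pos (hlt t ht))
    intervalIntegral.integral_same ((hH.continuousOn_primitive_inv ha0).comp hf hlt)
    (fun s _ t ht hst => hgf t ht ▸ hH.primitive_inv_sub_mul_le ha0 (hlt t ht) hst)
    (fun s hs t ht hst =>
      ((hH.strictMonoOn_primitive_inv ha0).lt_iff_lt (hlt s hs) (hlt t ht)).1 hst |>.le)
  refine ⟨f, hf, fun t ht => ⟨?_, hlt t ht, hcomp t ht⟩⟩
  rw [hfe t ht]
  congr 1
  refine intervalIntegral.integral_congr fun s hs => ?_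
  rw [uIcc_of_le ht.1] at hs
  rw [hgf s ⟨hs.1, hs.2.trans ht.2⟩]

/-- Continuous solutions of the Volterra equation with values at most `wmax` are unique. -/
lemma AssumptionH.solution_unique (hH : AssumptionH wmax wstar H) {k : ℝ → ℝ}
    (hk0 : ∀ t, 0 ≤ t → 0 ≤ k t) (hk : ∀ T, 0 ≤ T → IntervalIntegrable k volume 0 T)
    {a f₁ f₂ : ℝ → ℝ} {T : ℝ} (hT : 0 ≤ T)
    (hc₁ : ContinuousOn f₁ (Icc 0 T)) (hc₂ : ContinuousOn f₂ (Icc 0 T))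
    (hm₁ : ∀ t ∈ Icc 0 T, f₁ t ≤ wmax) (hm₂ : ∀ t ∈ Icc 0 T, f₂ t ≤ wmax)
    (he₁ : ∀ t ∈ Icc 0 T, f₁ t = a t + ∫ s in (0 : ℝ)..t, k (t - s) * H (f₁ s))
    (he₂ : ∀ t ∈ Icc 0 T, f₂ t = a t + ∫ s in (0 : ℝ)..t, k (t - s) * H (f₂ s)) :
    EqOn f₁ f₂ (Icc 0 T) := by
  obtain ⟨m₁, hb₁⟩ := isCompact_Icc.bddBelow_image hc₁
  obtain ⟨m₂, hb₂⟩ := isCompact_Icc.bddBelow_image hc₂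
  obtain ⟨L, hL⟩ := hH.exists_lipschitzOnWith (min m₁ m₂)
  exact volterra_unique hT hk0 hk hL hc₁ hc₂
    (fun t ht => ⟨(min_le_left _ _).trans (hb₁ (mem_image_of_mem _ ht)), hm₁ t ht⟩)
    (fun t ht => ⟨(min_le_right _ _).trans (hb₂ (mem_image_of_mem _ ht)), hm₂ t ht⟩) he₁ he₂

end Nonlinearity

lemma IsLpKernel.intervalIntegrable {κ : ℝ → ℝ} (hκ : IsLpKernel 1 κ) {T : ℝ} (hT : 0 ≤ T) :
    IntervalIntegrable κ volume 0 T := by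
  rcases hT.eq_or_lt with rfl | hT
  · exact IntervalIntegrable.refl
  · rw [intervalIntegrable_iff_integrableOn_Ioc_of_le hT.le]
    simpa using hκ.2.2 T hT

/-- A nonzero antitone kernel gives positive mass to positive functions. -/
lemma convolution_pos {k y : ℝ → ℝ} (hk0 : ∀ t, 0 ≤ t → 0 ≤ k t)
    (hk : ∀ T, 0 ≤ T → IntervalIntegrable k volume 0 T) (hdec : AntitoneOn k (Ioi 0))
    (hne : ∃ t > 0, k t ≠ 0) {t : ℝ} (ht : 0 < t) (hy : ContinuousOn y (Icc 0 t))
    (hpos : ∀ s ∈ Icc 0 t, 0 < y s) : 0 < ∫ s in (0 : ℝ)..t, k (t - s) * y s := by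
  obtain ⟨r, hr, hkr⟩ := hne
  have hkr' : 0 < k r := lt_of_le_of_ne (hk0 r hr.le) hkr.symm
  set p := max 0 (t - r) with hp
  have hp0 : 0 ≤ p := le_max_left _ _
  have hpt : p < t := max_lt ht (by linarith)
  have i1 := convolution_intervalIntegrable hk hp0 hpt.le (hy.mono (Icc_subset_Icc le_rfl hpt.le))
  have i2 := convolution_intervalIntegrable hk hpt.le le_rfl (hy.mono (Icc_subset_Icc hp0 le_rfl))
  rw [← intervalIntegral.integral_add_adjacent_intervals i1 i2]
  refine add_pos_of_nonneg_of_pos (intervalIntegral.integral_nonneg hp0 fun s hs => ?_)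
    (intervalIntegral.intervalIntegral_pos_of_pos_on i2 (fun s hs => ?_) hpt)
  · exact mul_nonneg (hk0 _ (by linarith [hs.2])) (hpos s ⟨hs.1, hs.2.trans hpt.le⟩).le
  · have h1 : t - r ≤ p := le_max_right _ _
    refine mul_pos (hkr'.trans_le (hdec ?_ hr (by linarith [hs.1])))
      (hpos s ⟨hp0.trans hs.1.le, hs.2.le⟩)
    exact mem_Ioi.2 (by linarith [hs.2])

/-- Theorem (Volterra, case (c)): for a continuous decreasing
`a : [0,∞) → (−∞, w_*)`, the Volterra equation
`f(t) = a(t) + ∫₀^t κ(t−s) H(f(s)) ds` has a unique global continuous solution,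
satisfying `a(t) < f(t) ≤ Q₂⁻¹(∫₀^t κ, a(0)) < w_*` for `t > 0`. -/
theorem volterra_case_c
    (wmax wstar : ℝ) (H : ℝ → ℝ) (hH : AssumptionH wmax wstar H)
    (κ : ℝ → ℝ) (hκ : IsLpKernel 1 κ) (hdec : AntitoneOn κ (Set.Ioi 0))
    (hne : ∃ t > 0, κ t ≠ 0)
    (a : ℝ → ℝ) (hacont : ContinuousOn a (Set.Ici 0))
    (hamono : AntitoneOn a (Set.Ici 0))
    (haval : ∀ t ≥ 0, a t < wstar) :
    let Q2 : ℝ → ℝ := fun w => ∫ ζ in (a 0)..w, (H ζ)⁻¹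
    let r2 : ℝ → ℝ := fun t =>
      Function.invFunOn Q2 (Set.Ico (a 0) wstar) (∫ s in (0:ℝ)..t, κ s)
    ∃ f : ℝ → ℝ,
      (ContinuousOn f (Set.Ici 0) ∧ (∀ t ≥ 0, f t ≤ wmax) ∧
        (∀ t ≥ 0, f t = a t + ∫ s in (0:ℝ)..t, κ (t - s) * H (f s))) ∧
      (∀ f' : ℝ → ℝ,
        (ContinuousOn f' (Set.Ici 0) ∧ (∀ t ≥ 0, f' t ≤ wmax) ∧
          (∀ t ≥ 0, f' t = a t + ∫ s in (0:ℝ)..t, κ (t - s) * H (f' s))) →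
        ∀ t ≥ 0, f' t = f t) ∧
      (∀ t > 0, a t < f t ∧ f t ≤ r2 t ∧ r2 t < wstar) := by
  intro Q2 r2
  have hk0 := hκ.1
  have hk : ∀ T, 0 ≤ T → IntervalIntegrable κ volume 0 T := fun T hT => hκ.intervalIntegrable hT
  have ha0 : a 0 < wstar := haval 0 le_rfl
  choose! F hFc hF using fun T (hT : (0 : ℝ) ≤ T) =>
    hH.exists_solution_on hk0 hk hdec hacont hamono ha0 hT
  have hFF : ∀ S T, 0 ≤ S → S ≤ T → EqOn (F S) (F T) (Icc 0 S) := by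
    intro S T hS hST
    have hsub : Icc 0 S ⊆ Icc 0 T := Icc_subset_Icc le_rfl hST
    have hT := hS.trans hST
    exact hH.solution_unique hk0 hk hS (hFc S hS) ((hFc T hT).mono hsub)
      (fun t ht => (hF S hS t ht).2.1.le.trans hH.1)
      (fun t ht => (hF T hT t (hsub ht)).2.1.le.trans hH.1)
      (fun t ht => (hF S hS t ht).1) (fun t ht => (hF T hT t (hsub ht)).1)
  let f : ℝ → ℝ := fun t => F t t
  have hfF : ∀ T, EqOn f (F T) (Icc 0 T) := fun T t ht =>
    hFF t T ht.1 ht.2 ⟨ht.1, le_rfl⟩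
  have hfT : ∀ T, 0 ≤ T → ContinuousOn f (Icc 0 T) := fun T hT => (hFc T hT).congr (hfF T)
  have hfc : ContinuousOn f (Ici 0) := by
    intro t ht
    refine (hfT (t + 1) (by linarith [mem_Ici.1 ht]) t ⟨ht, by linarith⟩).mono_of_mem_nhdsWithin ?_
    rw [← Ici_inter_Iic]
    exact inter_mem self_mem_nhdsWithin (mem_nhdsWithin_of_mem_nhds (Iic_mem_nhds (by linarith)))
  have hflt : ∀ t ≥ 0, f t < wstar := fun t ht => (hF t ht t ⟨ht, le_rfl⟩).2.1
  have hfe : ∀ t ≥ 0, f t = a t + ∫ s in (0:ℝ)..t, κ (t - s) * H (f s) := by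
    intro t ht
    refine (hF t ht t ⟨ht, le_rfl⟩).1.trans ?_
    congr 1
    refine intervalIntegral.integral_congr fun s hs => ?_
    rw [uIcc_of_le ht] at hs
    rw [hfF t hs]
  have hfm : ∀ t ≥ 0, f t ≤ wmax := fun t ht => (hflt t ht).le.trans hH.1
  refine ⟨f, ⟨hfc, hfm, hfe⟩, ?_, ?_⟩
  · rintro f' ⟨hc, hm, he⟩ t ht
    exact hH.solution_unique hk0 hk ht (hc.mono Icc_subset_Ici_self) (hfT t ht)
      (fun s hs => hm s hs.1) (fun s hs => hfm s hs.1) (fun s hs => he s hs.1)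
      (fun s hs => hfe s hs.1) ⟨ht, le_rfl⟩
  · intro t ht
    have hex : ∃ w ∈ Ico (a 0) wstar, Q2 w = ∫ s in (0:ℝ)..t, κ s :=
      hH.exists_primitive_inv_eq ha0
        (intervalIntegral.integral_nonneg ht.le fun u hu => hk0 u hu.1)
    have hr : r2 t ∈ Ico (a 0) wstar := Function.invFunOn_mem hex
    have hQr : Q2 (r2 t) = ∫ s in (0:ℝ)..t, κ s := Function.invFunOn_eq hex
    refine ⟨?_, ?_, hr.2⟩
    · have := convolution_pos hk0 hk hdec hne ht (y := fun s => H (f s))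
        (hH.2.1.continuousOn.comp (hfT t ht.le) fun s hs => hfm s hs.1)
        (fun s hs => hH.pos (hflt s hs.1))
      rw [hfe t ht.le]
      linarith
    · refine ((hH.strictMonoOn_primitive_inv ha0).le_iff_le (hflt t ht.le) hr.2).1 ?_
      exact (hF t ht.le t ⟨ht.le, le_rfl⟩).2.2.trans_eq hQr.symm
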